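/- Let L = D ⋊ E with D a finite abelian p-group of order p^n and E a p'-group of order e acting freely on D \ {1}, and let C be the Cartan matrix of the group algebra kL over an algebraically closed field k of characteristic p. Then det(C) = p^n = |D|. -/

import Mathlib

section Idempotents

/-- Idempotents congruent modulo the kernel of a retraction which reflects units are conjugate. -/
theorem exists_unit_conj_of_retraction {A R : Type*} [Ring A] [Ring R] (ρ : A →+* R) (σ : R →+* A)
    (hρσ : ∀ r, ρ (σ r) = r) (hunit : ∀ u, ρ u = 1 → IsUnit u) {e : A}
    (he : IsIdempotentElem e) : ∃ u : Aˣ, σ (ρ e) = u * e * ↑u⁻¹ := by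
  have he' : IsIdempotentElem (σ (ρ e)) := (he.map ρ).map σ
  set f := σ (ρ e) with hf
  obtain ⟨u, hu⟩ := hunit (f * e + (1 - f) * (1 - e)) (by
    have := (he.map ρ).eq
    simp only [map_add, map_mul, map_sub, map_one, hf, hρσ]
    noncomm_ring
    rw [this]
    abel)
  refine ⟨u, ?_⟩
  rw [Units.eq_mul_inv_iff_mul_eq, hu]
  have h1 := he.eq
  have h2 := he'.eq
  have h3 : f * (f * e) = f * e := by rw [← mul_assoc, h2]
  noncomm_ring
  simp only [h1, h2, h3]
  abel

/-- Conjugating the two idempotents does not change the dimension of `e A f`. -/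
theorem finrank_range_mulRight_comp_mulLeft_conj {k A : Type*} [Field k] [Ring A] [Algebra k A]
    (u v : Aˣ) (e f : A) :
    Module.finrank k (LinearMap.range ((LinearMap.mulRight k (v * f * ↑v⁻¹)).comp
      (LinearMap.mulLeft k (u * e * ↑u⁻¹)))) =
    Module.finrank k (LinearMap.range ((LinearMap.mulRight k f).comp
      (LinearMap.mulLeft k e))) := by
  let Φ : A ≃ₗ[k] A := LinearEquiv.ofLinearMap
    ((LinearMap.mulRight k (↑v⁻¹ : A)).comp (LinearMap.mulLeft k (u : A)))
    ((LinearMap.mulRight k (v : A)).comp (LinearMap.mulLeft k (↑u⁻¹ : A)))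
    (by ext x; simp [mul_assoc]) (by ext x; simp [mul_assoc])
  have h : (LinearMap.mulRight k (v * f * ↑v⁻¹)).comp (LinearMap.mulLeft k (u * e * ↑u⁻¹)) =
      (Φ.toLinearMap.comp ((LinearMap.mulRight k f).comp (LinearMap.mulLeft k e))).comp
        Φ.symm.toLinearMap := by
    ext x
    simp [Φ, mul_assoc]
  rw [h, LinearMap.range_comp_of_range_eq_top _ Φ.symm.range, LinearMap.range_comp]
  exact LinearEquiv.finrank_map_eq Φ _

/-- Idempotents `e = x y`, `f = y x` generate isomorphic left ideals. -/
theorem nonempty_span_equiv_of_mul_eq {A : Type*} [Ring A] {e f x y : A}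
    (hxf : x * f = x) (hye : y * e = y) (hxy : x * y = e) (hyx : y * x = f) :
    Nonempty (Submodule.span A {e} ≃ₗ[A] Submodule.span A {f}) := by
  have key : ∀ {a b z : A}, z * b = z → ∀ c : Submodule.span A {a},
      LinearMap.toSpanSingleton A A z c.1 ∈ Submodule.span A {b} := by
    intro a b z hz c
    rw [Submodule.mem_span_singleton]
    exact ⟨c.1 * z, by simp [mul_assoc, hz]⟩
  have he : IsIdempotentElem e := by
    rw [IsIdempotentElem]; nth_rw 1 [← hxy]; rw [mul_assoc, hye, hxy]
  have hf : IsIdempotentElem f := by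
    rw [IsIdempotentElem]; nth_rw 1 [← hyx]; rw [mul_assoc, hxf, hyx]
  have fix : ∀ {a : A}, IsIdempotentElem a → ∀ c : Submodule.span A {a}, c.1 * a = c.1 := by
    rintro a ha ⟨c, hc⟩
    obtain ⟨b, rfl⟩ := Submodule.mem_span_singleton.1 hc
    simp [mul_assoc, ha.eq]
  refine ⟨LinearEquiv.ofLinearMap
    (((LinearMap.toSpanSingleton A A x).comp (Submodule.subtype _)).codRestrict _ (key hxf))
    (((LinearMap.toSpanSingleton A A y).comp (Submodule.subtype _)).codRestrict _ (key hye))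
    ?_ ?_⟩
  · refine LinearMap.ext fun c => Subtype.ext ?_
    change c.1 * y * x = c.1
    rw [mul_assoc, hyx, fix hf c]
  · refine LinearMap.ext fun c => Subtype.ext ?_
    change c.1 * x * y = c.1
    rw [mul_assoc, hxy, fix he c]

end Idempotents

section Nilpotent

open MonoidAlgebra

variable {k : Type*} [Field k]

/-- Over a field of characteristic `p`, elements of augmentation zero in the group algebra of a
finite abelian `p`-group are nilpotent. -/
theorem MonoidAlgebra.ker_augmentation_le_nilradical {D : Type*} [CommGroup D] (p n : ℕ)
    [Fact p.Prime] [CharP k p] (hpow : ∀ d : D, d ^ p ^ n = 1) :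
    RingHom.ker (MonoidAlgebra.lift k k D (1 : D →* k)) ≤ nilradical (MonoidAlgebra k D) := by
  have : CharP (MonoidAlgebra k D) p := charP_of_injective_algebraMap
    (algebraMap k (MonoidAlgebra k D)).injective p
  have key : ∀ x : MonoidAlgebra k D, x ^ p ^ n =
      algebraMap k (MonoidAlgebra k D) (MonoidAlgebra.lift k k D (1 : D →* k) x ^ p ^ n) := by
    intro x
    induction x using MonoidAlgebra.induction_linear with
    | zero =>
      have hpn : p ^ n ≠ 0 := pow_ne_zero _ (Fact.out : p.Prime).ne_zero
      rw [map_zero, zero_pow hpn, zero_pow hpn, map_zero]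
    | add x y hx hy => rw [add_pow_char_pow, hx, hy, map_add, add_pow_char_pow, map_add]
    | single d c => simp [MonoidAlgebra.single_pow, hpow, MonoidAlgebra.lift_single]
  intro x hx
  refine mem_nilradical.2 ⟨p ^ n, ?_⟩
  rw [key, (RingHom.mem_ker).1 hx, zero_pow (pow_ne_zero _ (Fact.out : p.Prime).ne_zero), map_zero]

variable {D E : Type*} [CommGroup D] [Group E] (φ : E →* MulAut D)

/-- The projection `k[D ⋊ E] → k[E]`. -/
noncomputable abbrev semidirectProj : MonoidAlgebra k (D ⋊[φ] E) →ₐ[k] MonoidAlgebra k E :=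
  MonoidAlgebra.mapDomainAlgHom k k SemidirectProduct.rightHom

/-- The inclusion `k[E] → k[D ⋊ E]`. -/
noncomputable abbrev semidirectIncl : MonoidAlgebra k E →ₐ[k] MonoidAlgebra k (D ⋊[φ] E) :=
  MonoidAlgebra.mapDomainAlgHom k k SemidirectProduct.inr

theorem semidirectProj_semidirectIncl (x : MonoidAlgebra k E) :
    semidirectProj φ (semidirectIncl φ x) = x := by
  induction x using MonoidAlgebra.induction_linear with
  | zero => simp
  | add x y hx hy => rw [map_add, map_add, hx, hy]
  | single g c => simp

/-- The span of the elements `x g` with `x` in the ideal `I` of `k[D]` and `g` in `E`. -/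
noncomputable def semidirectSpan (I : Ideal (MonoidAlgebra k D)) :
    Submodule k (MonoidAlgebra k (D ⋊[φ] E)) :=
  Submodule.span k {z | ∃ x ∈ I, ∃ g : E,
    z = MonoidAlgebra.mapDomainAlgHom k k SemidirectProduct.inl x *
      MonoidAlgebra.single (SemidirectProduct.inr g) 1}

theorem single_inr_mul_mapDomain_inl (g : E) (x : MonoidAlgebra k D) :
    (MonoidAlgebra.single (SemidirectProduct.inr g) 1 : MonoidAlgebra k (D ⋊[φ] E)) *
      MonoidAlgebra.mapDomainAlgHom k k SemidirectProduct.inl x =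
    MonoidAlgebra.mapDomainAlgHom k k SemidirectProduct.inl
      (MonoidAlgebra.mapDomainAlgHom k k (φ g).toMonoidHom x) *
      MonoidAlgebra.single (SemidirectProduct.inr g) 1 := by
  induction x using MonoidAlgebra.induction_linear with
  | zero => simp
  | add x y hx hy => simp only [map_add, mul_add, add_mul, hx, hy]
  | single d c => simp [MonoidAlgebra.single_mul_single, SemidirectProduct.inl_aut]

theorem semidirectSpan_mul_le {I J : Ideal (MonoidAlgebra k D)}
    (hJ : ∀ g : E, ∀ x ∈ J, MonoidAlgebra.mapDomainAlgHom k k (φ g).toMonoidHom x ∈ J) :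
    semidirectSpan φ I * semidirectSpan φ J ≤ semidirectSpan φ (I * J) := by
  rw [semidirectSpan, semidirectSpan, Submodule.span_mul_span]
  refine Submodule.span_le.2 ?_
  rintro _ ⟨_, ⟨x, hx, g, rfl⟩, _, ⟨y, hy, h, rfl⟩, rfl⟩
  refine Submodule.subset_span ⟨_, Ideal.mul_mem_mul hx (hJ g y hy), g * h, ?_⟩
  dsimp only
  rw [mul_assoc, ← mul_assoc (single _ _), single_inr_mul_mapDomain_inl, map_mul, map_mul]
  simp [mul_assoc, MonoidAlgebra.single_mul_single]

/-- Elements of `k[D ⋊ E]` mapping to `1` in `k[E]` are units. -/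
theorem isUnit_of_semidirectProj_eq_one [Finite D] (p n : ℕ) [Fact p.Prime] [CharP k p]
    (hpow : ∀ d : D, d ^ p ^ n = 1) (u : MonoidAlgebra k (D ⋊[φ] E))
    (hu : semidirectProj φ u = 1) : IsUnit u := by
  set I := RingHom.ker (MonoidAlgebra.lift k k D (1 : D →* k)) with hI
  have hstable : ∀ g : E, ∀ x ∈ I,
      MonoidAlgebra.mapDomainAlgHom k k (φ g).toMonoidHom x ∈ I := by
    intro g x hx
    have : (MonoidAlgebra.lift k k D (1 : D →* k)).comp
        (MonoidAlgebra.mapDomainAlgHom k k (φ g).toMonoidHom) =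
        MonoidAlgebra.lift k k D (1 : D →* k) := by
      ext; simp
    rw [hI, RingHom.mem_ker, ← AlgHom.comp_apply, this]
    exact hx
  have hpowI : ∀ r, semidirectSpan (E := E) φ I ^ (r + 1) ≤ semidirectSpan φ (I ^ (r + 1)) := by
    intro r
    induction r with
    | zero => simp
    | succ r ih =>
      rw [pow_succ, pow_succ I]
      exact (mul_le_mul' ih le_rfl).trans (semidirectSpan_mul_le φ hstable)
  have hmem : ∀ z : MonoidAlgebra k (D ⋊[φ] E),
      z - semidirectIncl φ (semidirectProj φ z) ∈ semidirectSpan φ I := by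
    intro z
    induction z using MonoidAlgebra.induction_linear with
    | zero => simp
    | add x y hx hy =>
      rw [map_add, map_add, add_sub_add_comm]
      exact add_mem hx hy
    | single l c =>
      refine Submodule.subset_span ⟨single l.left c - single 1 c, ?_, l.right, ?_⟩
      · rw [hI, RingHom.mem_ker, map_sub]
        simp [MonoidAlgebra.lift_single]
      · rw [map_sub, sub_mul]
        simp [MonoidAlgebra.single_mul_single]
  have : IsNoetherianRing (MonoidAlgebra k D) := IsNoetherianRing.of_finite k _
  obtain ⟨r, hr⟩ : IsNilpotent I := (Ideal.FG.isNilpotent_iff_le_nilradical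
    (IsNoetherian.noetherian I)).2 (MonoidAlgebra.ker_augmentation_le_nilradical p n hpow)
  have hnil : IsNilpotent (u - 1) := by
    refine ⟨r + 1, ?_⟩
    have h1 := hmem u
    rw [hu, map_one] at h1
    have h2 := hpowI r (Submodule.pow_mem_pow _ h1 (r + 1))
    rw [pow_succ, hr, zero_mul] at h2
    have h3 : semidirectSpan (E := E) φ (0 : Ideal (MonoidAlgebra k D)) ≤ ⊥ := by
      refine Submodule.span_le.2 ?_
      rintro _ ⟨x, hx, g, rfl⟩
      have hx0 : x = 0 := hx
      simp [hx0]
    exact (Submodule.mem_bot k).1 (h3 h2)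
  simpa using hnil.isUnit_add_one

end Nilpotent

section Dimension

open TensorProduct MonoidAlgebra

/-- A fixed-point-free action on `D \ {1}` admits a transversal, and its orbits are regular. -/
theorem exists_transversal_of_free {D E : Type} [Group D] [Finite D] [Group E] [Finite E]
    (φ : E →* MulAut D) (hfree : ∀ f : E, f ≠ 1 → ∀ d : D, d ≠ 1 → φ f d ≠ d) :
    ∃ (T : Type) (_ : Fintype T) (t : T → D), (∀ d : D, d ≠ 1 → ∃ g τ, φ g (t τ) = d) ∧
      Nat.card D = 1 + Fintype.card T * Nat.card E := by
  let : MulAction E {d : D // d ≠ 1} :=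
    { smul := fun g d => ⟨φ g d.1, by simpa using d.2⟩
      one_smul := fun d => Subtype.ext (by change φ 1 d.1 = d.1; simp)
      mul_smul := fun g h d => Subtype.ext (by
        change φ (g * h) d.1 = φ g (φ h d.1); simp) }
  have hstab : ∀ d : {d : D // d ≠ 1}, MulAction.stabilizer E d = ⊥ := by
    intro d
    rw [Subgroup.eq_bot_iff_forall]
    intro g hg
    by_contra hne
    exact hfree g hne d.1 d.2 (congrArg Subtype.val (MulAction.mem_stabilizer_iff.1 hg))
  let : Fintype (MulAction.orbitRel.Quotient E {d : D // d ≠ 1}) := Fintype.ofFinite _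
  refine ⟨MulAction.orbitRel.Quotient E {d : D // d ≠ 1}, inferInstance,
    fun τ => (Quotient.out τ).1, ?_, ?_⟩
  · intro d hd
    obtain ⟨g, hg⟩ : (⟨d, hd⟩ : {d : D // d ≠ 1}) ∈ MulAction.orbit E (Quotient.out
        (Quotient.mk (MulAction.orbitRel E {d : D // d ≠ 1}) ⟨d, hd⟩)) :=
      MulAction.orbitRel_apply.1 ((MulAction.orbitRel E _).symm (Quotient.mk_out _))
    exact ⟨g, _, congrArg Subtype.val hg⟩
  · have h1 := Nat.card_congr (MulAction.selfEquivOrbitsQuotientProd hstab)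
    rw [Nat.card_prod] at h1
    have h2 : Nat.card D = 1 + Nat.card {d : D // d ≠ 1} := by
      classical
      rw [Nat.card_congr (Equiv.sumCompl (fun d : D => d = 1)).symm, Nat.card_sum]
      simp
    rw [h2, h1, ← Nat.card_eq_fintype_card]

/-- If `A` is, through `Φ`, the direct sum of a copy of `B` and copies of `B ⊗ B` as a
`B`-bimodule, the dimension of `f A g` is the sum of the corresponding dimensions. -/
theorem finrank_range_sandwich_of_decomposition {k A B T : Type*} [Field k] [Ring A] [Algebra k A]
    [Ring B] [Algebra k B] [FiniteDimensional k B] [Fintype T] (ι : B →ₐ[k] A)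
    (Φ : (B × (T → B ⊗[k] B)) ≃ₗ[k] A) (t : T → A)
    (hΦ₁ : ∀ z, Φ (z, 0) = ι z)
    (hΦ₂ : ∀ w : T → B ⊗[k] B, Φ (0, w) = ∑ τ, TensorProduct.lift
      ((LinearMap.mul k A).compl₁₂ ((LinearMap.mulRight k (t τ)).comp ι.toLinearMap)
        ι.toLinearMap) (w τ)) (f g : B) :
    Module.finrank k (LinearMap.range ((LinearMap.mulRight k (ι g)).comp
      (LinearMap.mulLeft k (ι f)))) =
    Module.finrank k (LinearMap.range ((LinearMap.mulRight k g).comp (LinearMap.mulLeft k f))) +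
      Fintype.card T * (Module.finrank k (LinearMap.range (LinearMap.mulLeft k f)) *
        Module.finrank k (LinearMap.range (LinearMap.mulRight k g))) := by
  set C := (LinearMap.mulRight k g).comp (LinearMap.mulLeft k f) with hC
  set P := LinearMap.mulLeft k f with hP
  set Q := LinearMap.mulRight k g with hQ
  let S : (B × (T → B ⊗[k] B)) →ₗ[k] (LinearMap.range C ×
      (T → LinearMap.range P ⊗[k] LinearMap.range Q)) :=
    C.rangeRestrict.prodMap ((TensorProduct.map P.rangeRestrict Q.rangeRestrict).compLeft T)
  let J : (LinearMap.range C × (T → LinearMap.range P ⊗[k] LinearMap.range Q)) →ₗ[k]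
      (B × (T → B ⊗[k] B)) :=
    (LinearMap.range C).subtype.prodMap ((TensorProduct.map (LinearMap.range P).subtype
      (LinearMap.range Q).subtype).compLeft T)
  have hS : Function.Surjective S := by
    have h := (TensorProduct.map_surjective P.surjective_rangeRestrict
      Q.surjective_rangeRestrict).comp_left (α := T)
    exact C.surjective_rangeRestrict.prodMap h
  have hJ : Function.Injective J := by
    have h := (TensorProduct.map_injective_of_flat_flat (LinearMap.range P).subtype
      (LinearMap.range Q).subtype (Submodule.subtype_injective _)
      (Submodule.subtype_injective _)).comp_left (α := T)
    exact (LinearMap.range C).subtype_injective.prodMap h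
  have hcomm : ((LinearMap.mulRight k (ι g)).comp (LinearMap.mulLeft k (ι f))).comp
      Φ.toLinearMap = (Φ.toLinearMap.comp J).comp S := by
    have hten : ∀ (τ : T) (w : B ⊗[k] B), ι f * (TensorProduct.lift
      ((LinearMap.mul k A).compl₁₂ ((LinearMap.mulRight k (t τ)).comp ι.toLinearMap)
        ι.toLinearMap) w) * ι g = TensorProduct.lift
      ((LinearMap.mul k A).compl₁₂ ((LinearMap.mulRight k (t τ)).comp ι.toLinearMap)
        ι.toLinearMap) (TensorProduct.map (LinearMap.range P).subtype
      (LinearMap.range Q).subtype (TensorProduct.map P.rangeRestrict Q.rangeRestrict w)) := by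
      intro τ w
      induction w using TensorProduct.induction_on with
      | zero => simp
      | tmul x y => simp [P, Q, mul_assoc]
      | add x y hx hy => simp only [map_add, mul_add, add_mul, hx, hy]
    refine LinearMap.prod_ext (LinearMap.ext fun z => ?_) (LinearMap.ext fun w => ?_)
    · change ι f * Φ (z, 0) * ι g = Φ (J (S (z, 0)))
      have : J (S (z, 0)) = (C z, 0) := by
        refine Prod.ext rfl (funext fun τ => ?_)
        simp [J, S]
      rw [this, hΦ₁, hΦ₁]
      simp [C]
    · change ι f * Φ (0, w) * ι g = Φ (J (S (0, w)))
      have : J (S (0, w)) = (0, (J (S (0, w))).2) := by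
        refine Prod.ext ?_ rfl
        simp [J, S]
      rw [this, hΦ₂, hΦ₂, Finset.mul_sum, Finset.sum_mul]
      exact Finset.sum_congr rfl fun τ _ => hten τ (w τ)
  rw [← LinearMap.range_comp_of_range_eq_top _ Φ.range, hcomm,
    LinearMap.range_comp_of_range_eq_top _ (LinearMap.range_eq_top.2 hS),
    LinearMap.finrank_range_of_inj (by exact Φ.injective.comp hJ), Module.finrank_prod,
    Module.finrank_pi_fintype]
  simp [Module.finrank_tensorProduct]

/-- The dimension of `f k[D ⋊ E] g` for `f, g` in `k[E]`, when `E` acts freely on `D \ {1}`. -/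
theorem exists_finrank_range_sandwich {k D E : Type} [Field k] [CommGroup D] [Finite D] [Group E]
    [Finite E] (φ : E →* MulAut D) (hfree : ∀ f : E, f ≠ 1 → ∀ d : D, d ≠ 1 → φ f d ≠ d) :
    ∃ m : ℕ, Nat.card D = 1 + m * Nat.card E ∧ ∀ f g : MonoidAlgebra k E,
      Module.finrank k (LinearMap.range ((LinearMap.mulRight k (semidirectIncl φ g)).comp
        (LinearMap.mulLeft k (semidirectIncl φ f)))) =
      Module.finrank k (LinearMap.range ((LinearMap.mulRight k g).comp (LinearMap.mulLeft k f))) +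
        m * (Module.finrank k (LinearMap.range (LinearMap.mulLeft k f)) *
          Module.finrank k (LinearMap.range (LinearMap.mulRight k g))) := by
  classical
  obtain ⟨T, _, t, ht, hcard⟩ := exists_transversal_of_free φ hfree
  refine ⟨Fintype.card T, hcard, ?_⟩
  have := Finite.of_equiv _ (SemidirectProduct.equivProd (φ := φ)).symm
  let s : T → MonoidAlgebra k (D ⋊[φ] E) := fun τ => single (SemidirectProduct.inl (t τ)) 1
  let ι := semidirectIncl (k := k) φ
  let Ψ : T → (MonoidAlgebra k E ⊗[k] MonoidAlgebra k E →ₗ[k] MonoidAlgebra k (D ⋊[φ] E)) :=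
    fun τ => TensorProduct.lift ((LinearMap.mul k _).compl₁₂
      ((LinearMap.mulRight k (s τ)).comp ι.toLinearMap) ι.toLinearMap)
  let Φ : (MonoidAlgebra k E × (T → MonoidAlgebra k E ⊗[k] MonoidAlgebra k E)) →ₗ[k]
      MonoidAlgebra k (D ⋊[φ] E) :=
    LinearMap.coprod ι.toLinearMap (∑ τ, (Ψ τ).comp (LinearMap.proj τ))
  have hΦ₁ : ∀ z, Φ (z, 0) = ι z := by intro z; simp [Φ]
  have hΦ₂ : ∀ w, Φ (0, w) = ∑ τ, Ψ τ (w τ) := by intro w; simp [Φ]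
  have hsurj : Function.Surjective Φ := by
    rw [← LinearMap.range_eq_top, eq_top_iff]
    intro z _
    induction z using MonoidAlgebra.induction_linear with
    | zero => exact zero_mem _
    | add x y hx hy => exact add_mem (hx trivial) (hy trivial)
    | single l c =>
      by_cases hl : l.left = 1
      · refine ⟨(single l.right c, 0), ?_⟩
        rw [hΦ₁]
        simp only [ι, semidirectIncl, MonoidAlgebra.mapDomainAlgHom_apply,
          MonoidAlgebra.mapDomain_single]
        congr 1
        ext <;> simp [hl]
      · obtain ⟨g, τ, hg⟩ := ht l.left hl
        refine ⟨(0, Pi.single τ (single g c ⊗ₜ single (g⁻¹ * l.right) 1)), ?_⟩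
        rw [hΦ₂, Finset.sum_eq_single τ (fun τ' _ h => by simp [h]) (by simp)]
        simp only [Pi.single_eq_same, Ψ, s, ι, TensorProduct.lift.tmul,
          LinearMap.compl₁₂_apply, LinearMap.mul_apply', LinearMap.comp_apply,
          AlgHom.toLinearMap_apply, LinearMap.mulRight_apply,
          MonoidAlgebra.mapDomainAlgHom_apply,
          MonoidAlgebra.mapDomain_single, MonoidAlgebra.single_mul_single, mul_one]
        congr 1
        ext <;> simp [hg]
  have hdim : Module.finrank k
      (MonoidAlgebra k E × (T → MonoidAlgebra k E ⊗[k] MonoidAlgebra k E)) =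
      Module.finrank k (MonoidAlgebra k (D ⋊[φ] E)) := by
    have hfr : ∀ (G : Type) [Finite G], Module.finrank k (MonoidAlgebra k G) = Nat.card G := by
      intro G _
      exact Module.finrank_eq_nat_card_basis (MonoidAlgebra.basis G k)
    rw [Module.finrank_prod, Module.finrank_pi_fintype]
    simp only [Module.finrank_tensorProduct, hfr, Finset.sum_const, Finset.card_univ, smul_eq_mul]
    rw [Nat.card_congr (SemidirectProduct.equivProd (φ := φ)), Nat.card_prod, hcard]
    ring
  let Φe := LinearEquiv.ofBijective Φ
    ⟨(LinearMap.injective_iff_surjective_of_finrank_eq_finrank hdim).2 hsurj, hsurj⟩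
  exact finrank_range_sandwich_of_decomposition ι Φe s hΦ₁ hΦ₂

end Dimension

section PiMatrix

open Matrix

/-- A primitive idempotent: nonzero, idempotent, and not a sum of two nonzero orthogonal
idempotents. -/
structure IsPrimitiveIdempotent {A : Type*} [Ring A] (e : A) : Prop where
  idem : IsIdempotentElem e
  ne_zero : e ≠ 0
  indecomposable : ∀ a b : A, IsIdempotentElem a → IsIdempotentElem b → a * b = 0 → b * a = 0 →
    a + b = e → a = 0 ∨ b = 0

/-- A nonzero idempotent below a primitive idempotent is equal to it. -/
theorem IsPrimitiveIdempotent.eq_of_mul_eq {A : Type*} [Ring A] {e a : A}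
    (he : IsPrimitiveIdempotent e) (ha : IsIdempotentElem a) (h₁ : e * a = a) (h₂ : a * e = a)
    (ha0 : a ≠ 0) : e = a := by
  have hb : IsIdempotentElem (e - a) := by
    rw [IsIdempotentElem, mul_sub, sub_mul, sub_mul, he.idem.eq, h₁, h₂, ha.eq]
    abel
  rcases he.indecomposable a (e - a) ha hb (by rw [mul_sub, h₂, ha.eq, sub_self])
    (by rw [sub_mul, h₁, ha.eq, sub_self]) (by abel) with h | h
  · exact absurd h ha0
  · exact sub_eq_zero.1 h

variable {k : Type*} [Field k] {S : Type*} [DecidableEq S] {d : S → ℕ}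

/-- Primitive idempotents of a product of matrix algebras have rank one. -/
theorem IsPrimitiveIdempotent.exists_eq_single_vecMulVec
    {f : Π s, Matrix (Fin (d s)) (Fin (d s)) k} (hf : IsPrimitiveIdempotent f) :
    ∃ (s : S) (v w : Fin (d s) → k), w ⬝ᵥ v = 1 ∧ f = Pi.single s (vecMulVec v w) := by
  obtain ⟨s, hs⟩ := Function.ne_iff.1 hf.ne_zero
  have hidem : f s * f s = f s := congrFun hf.idem.eq s
  obtain ⟨x, hx⟩ : ∃ x, f s *ᵥ x ≠ 0 := by
    by_contra! h
    exact hs (Matrix.ext_of_mulVec_single fun i => by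
      rw [h, Pi.zero_apply, zero_mulVec])
  set v := f s *ᵥ x with hv
  have hfv : f s *ᵥ v = v := by rw [hv, mulVec_mulVec, hidem]
  obtain ⟨i, hi⟩ := Function.ne_iff.1 hx
  set w₀ : Fin (d s) → k := Pi.single i (v i)⁻¹ with hw₀
  have hw₀v : w₀ ⬝ᵥ v = 1 := by
    simp only [hw₀, single_dotProduct]
    exact inv_mul_cancel₀ hi
  set w := w₀ ᵥ* f s with hw
  have hwv : w ⬝ᵥ v = 1 := by rw [hw, ← dotProduct_mulVec, hfv, hw₀v]
  have hwf : w ᵥ* f s = w := by rw [hw, vecMul_vecMul, hidem]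
  refine ⟨s, v, w, hwv, hf.eq_of_mul_eq ?_ ?_ ?_ ?_⟩
  · rw [IsIdempotentElem, ← Pi.single_mul, vecMulVec_mul_vecMulVec, hwv, one_smul]
  · rw [← Pi.single_mul_right, mul_vecMulVec, hfv]
  · rw [← Pi.single_mul_left, vecMulVec_mul, hwf]
  · intro h
    have h1 := congrFun h s
    rw [Pi.single_eq_same] at h1
    have h2 := congrArg (· *ᵥ v) h1
    simp only [vecMulVec_mulVec, hwv, Pi.zero_apply, zero_mulVec] at h2
    exact hx (by simpa using h2)

theorem finrank_range_mulLeft_single_vecMulVec {s : S} {v w : Fin (d s) → k} (h : w ⬝ᵥ v = 1) :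
    Module.finrank k (LinearMap.range (LinearMap.mulLeft k
      (Pi.single s (vecMulVec v w) : Π s, Matrix (Fin (d s)) (Fin (d s)) k))) = d s := by
  let L : (Fin (d s) → k) →ₗ[k] Π s, Matrix (Fin (d s)) (Fin (d s)) k :=
    (LinearMap.single k _ s).comp (vecMulVecBilin k k v)
  have hL : ∀ u, L u = Pi.single s (vecMulVec v u) := fun _ => rfl
  have hinj : Function.Injective L := by
    intro u u' huu
    rw [hL, hL] at huu
    have h1 := congrArg (w ᵥ* ·) (Pi.single_injective s huu)
    simpa [vecMul_vecMulVec, h] using h1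
  have hrange : LinearMap.range (LinearMap.mulLeft k
      (Pi.single s (vecMulVec v w) : Π s, Matrix (Fin (d s)) (Fin (d s)) k)) =
      LinearMap.range L := by
    ext x
    constructor
    · rintro ⟨y, rfl⟩
      exact ⟨w ᵥ* y s, by rw [hL, LinearMap.mulLeft_apply, ← Pi.single_mul_left, vecMulVec_mul]⟩
    · rintro ⟨u, rfl⟩
      exact ⟨L u, by rw [hL, LinearMap.mulLeft_apply, ← Pi.single_mul,
        vecMulVec_mul_vecMulVec, h, one_smul]⟩
  rw [hrange, LinearMap.finrank_range_of_inj hinj, Module.finrank_fin_fun]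

theorem finrank_range_mulRight_single_vecMulVec {s : S} {v w : Fin (d s) → k} (h : w ⬝ᵥ v = 1) :
    Module.finrank k (LinearMap.range (LinearMap.mulRight k
      (Pi.single s (vecMulVec v w) : Π s, Matrix (Fin (d s)) (Fin (d s)) k))) = d s := by
  let L : (Fin (d s) → k) →ₗ[k] Π s, Matrix (Fin (d s)) (Fin (d s)) k :=
    (LinearMap.single k _ s).comp ((vecMulVecBilin k k).flip w)
  have hL : ∀ u, L u = Pi.single s (vecMulVec u w) := fun _ => rfl
  have hinj : Function.Injective L := by
    intro u u' huu
    rw [hL, hL] at huu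
    have h1 := congrArg (· *ᵥ v) (Pi.single_injective s huu)
    simpa [vecMulVec_mulVec, h] using h1
  have hrange : LinearMap.range (LinearMap.mulRight k
      (Pi.single s (vecMulVec v w) : Π s, Matrix (Fin (d s)) (Fin (d s)) k)) =
      LinearMap.range L := by
    ext x
    constructor
    · rintro ⟨y, rfl⟩
      exact ⟨y s *ᵥ v, by rw [hL, LinearMap.mulRight_apply, ← Pi.single_mul_right, mul_vecMulVec]⟩
    · rintro ⟨u, rfl⟩
      exact ⟨L u, by rw [hL, LinearMap.mulRight_apply, ← Pi.single_mul,
        vecMulVec_mul_vecMulVec, h, one_smul]⟩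
  rw [hrange, LinearMap.finrank_range_of_inj hinj, Module.finrank_fin_fun]

theorem finrank_range_sandwich_single_same {s : S} {v w v' w' : Fin (d s) → k}
    (h : w ⬝ᵥ v = 1) (h' : w' ⬝ᵥ v' = 1) :
    Module.finrank k (LinearMap.range ((LinearMap.mulRight k
      (Pi.single s (vecMulVec v' w') : Π s, Matrix (Fin (d s)) (Fin (d s)) k)).comp
      (LinearMap.mulLeft k (Pi.single s (vecMulVec v w))))) = 1 := by
  let y : Π s, Matrix (Fin (d s)) (Fin (d s)) k := Pi.single s (vecMulVec v w')
  have hy : y ≠ 0 := by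
    intro h0
    have h1 := congrArg (w ᵥ* · ⬝ᵥ v') (congrFun h0 s)
    simp [y, vecMul_vecMulVec, h, h'] at h1
  have hrange : LinearMap.range ((LinearMap.mulRight k
      (Pi.single s (vecMulVec v' w') : Π s, Matrix (Fin (d s)) (Fin (d s)) k)).comp
      (LinearMap.mulLeft k (Pi.single s (vecMulVec v w)))) = Submodule.span k {y} := by
    ext x
    rw [Submodule.mem_span_singleton]
    constructor
    · rintro ⟨x, rfl⟩
      refine ⟨(w ᵥ* x s) ⬝ᵥ v', ?_⟩
      rw [LinearMap.comp_apply, LinearMap.mulLeft_apply, LinearMap.mulRight_apply,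
        ← Pi.single_mul_left, ← Pi.single_mul, vecMulVec_mul, vecMulVec_mul_vecMulVec,
        ← Pi.single_smul, vecMulVec_smul]
    · rintro ⟨c, rfl⟩
      refine ⟨c • Pi.single s (vecMulVec v w'), ?_⟩
      rw [map_smul, LinearMap.comp_apply, LinearMap.mulLeft_apply, LinearMap.mulRight_apply,
        ← Pi.single_mul, ← Pi.single_mul, vecMulVec_mul_vecMulVec, h, one_smul,
        vecMulVec_mul_vecMulVec, h', one_smul]
  rw [hrange, finrank_span_singleton hy]

theorem finrank_range_sandwich_single_ne {s s' : S} (hss : s ≠ s')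
    (a : Matrix (Fin (d s)) (Fin (d s)) k) (b : Matrix (Fin (d s')) (Fin (d s')) k) :
    Module.finrank k (LinearMap.range ((LinearMap.mulRight k
      (Pi.single s' b : Π s, Matrix (Fin (d s)) (Fin (d s)) k)).comp
      (LinearMap.mulLeft k (Pi.single s a)))) = 0 := by
  have h0 : (LinearMap.mulRight k
      (Pi.single s' b : Π s, Matrix (Fin (d s)) (Fin (d s)) k)).comp
      (LinearMap.mulLeft k (Pi.single s a)) = 0 := by
    refine LinearMap.ext fun x => ?_
    rw [LinearMap.comp_apply, LinearMap.mulLeft_apply, LinearMap.mulRight_apply,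
      ← Pi.single_mul_left, LinearMap.zero_apply]
    ext1 t
    by_cases ht : t = s
    · subst ht
      simp [Pi.single_eq_of_ne hss]
    · simp [Pi.single_eq_of_ne ht]
  rw [h0, LinearMap.range_zero, finrank_bot]

end PiMatrix

section Cartan

open Matrix

variable {k A S : Type} [Field k] [Ring A] [DecidableEq S] {d : S → ℕ}

/-- Two rank one idempotents in the same block of a product of matrix algebras factor through
each other. -/
theorem exists_mul_eq_of_single_vecMulVec {s s' : S} (hs : s = s') {v w : Fin (d s) → k}
    {v' w' : Fin (d s') → k} (h : w ⬝ᵥ v = 1) (h' : w' ⬝ᵥ v' = 1) :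
    ∃ x y : Π s, Matrix (Fin (d s)) (Fin (d s)) k,
      x * Pi.single s' (vecMulVec v' w') = x ∧ y * Pi.single s (vecMulVec v w) = y ∧
      x * y = Pi.single s (vecMulVec v w) ∧ y * x = Pi.single s' (vecMulVec v' w') := by
  subst hs
  refine ⟨Pi.single s (vecMulVec v w'), Pi.single s (vecMulVec v' w), ?_, ?_, ?_, ?_⟩ <;>
    rw [← Pi.single_mul, vecMulVec_mul_vecMulVec] <;> simp [h, h']

theorem finrank_range_sandwich_single_vecMulVec {s s' : S} {v w : Fin (d s) → k}
    {v' w' : Fin (d s') → k} (h : w ⬝ᵥ v = 1) (h' : w' ⬝ᵥ v' = 1) :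
    Module.finrank k (LinearMap.range ((LinearMap.mulRight k
      (Pi.single s' (vecMulVec v' w') : Π s, Matrix (Fin (d s)) (Fin (d s)) k)).comp
      (LinearMap.mulLeft k (Pi.single s (vecMulVec v w))))) = if s = s' then 1 else 0 := by
  split_ifs with hs
  · subst hs
    exact finrank_range_sandwich_single_same h h'
  · exact finrank_range_sandwich_single_ne hs _ _

/-- Primitivity passes to the image under a retraction which reflects units. -/
theorem IsPrimitiveIdempotent.map_retraction {A R : Type*} [Ring A] [Ring R] (ρ : A →+* R)
    (σ : R →+* A) (hρσ : ∀ r, ρ (σ r) = r) (hunit : ∀ u, ρ u = 1 → IsUnit u) {e : A}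
    (he : IsPrimitiveIdempotent e) : IsPrimitiveIdempotent (ρ e) := by
  obtain ⟨u, hu⟩ := exists_unit_conj_of_retraction ρ σ hρσ hunit he.idem
  have hu' : ↑u⁻¹ * σ (ρ e) * ↑u = e := by rw [hu]; simp [mul_assoc]
  have hconj : ∀ x y : R, (↑u⁻¹ * σ x * ↑u) * (↑u⁻¹ * σ y * ↑u) = ↑u⁻¹ * σ (x * y) * ↑u := by
    intro x y
    simp [mul_assoc]
  have hzero : ∀ x : R, ↑u⁻¹ * σ x * ↑u = 0 → x = 0 := by
    intro x hx
    have h : σ x = 0 := by simpa using hx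
    rw [← hρσ x, h, map_zero]
  refine ⟨he.idem.map ρ, ?_, ?_⟩
  · intro h
    exact he.ne_zero (by rw [← hu', h]; simp)
  · intro a b ha hb hab hba hsum
    rcases he.indecomposable (↑u⁻¹ * σ a * ↑u) (↑u⁻¹ * σ b * ↑u)
      (by rw [IsIdempotentElem, hconj, ha.eq]) (by rw [IsIdempotentElem, hconj, hb.eq])
      (by rw [hconj, hab]; simp) (by rw [hconj, hba]; simp)
      (by rw [← hu', ← hsum, map_add, mul_add, add_mul]) with h | h
    · exact Or.inl (hzero a h)
    · exact Or.inr (hzero b h)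

/-- If every simple `A`-module is acted on nontrivially by some `e i`, then every block of a split
semisimple quotient of `A` contains a nonzero component of some `e i`. -/
theorem exists_component_ne_zero [∀ s, NeZero (d s)] {ι : Type} (e : ι → A)
    (ρ : A →+* Π s, Matrix (Fin (d s)) (Fin (d s)) k) (hρ : Function.Surjective ρ)
    (hcomplete : ∀ (M : Type) [AddCommGroup M] [Module A M],
      IsSimpleModule A M → ∃ i, ∃ m : M, e i • m ≠ 0) (s : S) : ∃ i, ρ (e i) s ≠ 0 := by
  let : Module A (Fin (d s) → k) := Module.compHom (Fin (d s) → k)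
    ((Matrix.toLinAlgEquiv' (R := k) (n := Fin (d s))).toRingEquiv.toRingHom.comp
      ((Pi.evalRingHom _ s).comp ρ))
  have hsmul : ∀ (a : A) (x : Fin (d s) → k), a • x = ρ a s *ᵥ x := fun _ _ => rfl
  have hsimple : IsSimpleModule A (Fin (d s) → k) := by
    refine isSimpleModule_iff_toSpanSingleton_surjective.2 ⟨inferInstance, fun u hu x => ?_⟩
    obtain ⟨i, hi⟩ := Function.ne_iff.1 hu
    obtain ⟨a, ha⟩ := hρ (Pi.single s (vecMulVec x (Pi.single i (u i)⁻¹)))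
    refine ⟨a, ?_⟩
    have hi' : (u i)⁻¹ * u i = 1 := inv_mul_cancel₀ hi
    rw [LinearMap.toSpanSingleton_apply, hsmul, ha, Pi.single_eq_same, vecMulVec_mulVec,
      single_dotProduct, hi']
    simp
  obtain ⟨i, m, hm⟩ := hcomplete _ hsimple
  refine ⟨i, fun h => hm ?_⟩
  rw [hsmul, h, zero_mulVec]

/-- The Cartan determinant of an algebra `A` which retracts onto a split semisimple algebra
`∏ s, M_{d s}(k)`, such that `A` is a sum of the regular bimodule and `m` free bimodules. -/
theorem det_cartan_of_retraction [Algebra k A] [Fintype S] [∀ s, NeZero (d s)]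
    (ρ : A →ₐ[k] Π s, Matrix (Fin (d s)) (Fin (d s)) k)
    (σ : (Π s, Matrix (Fin (d s)) (Fin (d s)) k) →ₐ[k] A) (hρσ : ∀ r, ρ (σ r) = r)
    (hunit : ∀ u, ρ u = 1 → IsUnit u) (m : ℕ)
    (hdim : ∀ f g, Module.finrank k (LinearMap.range ((LinearMap.mulRight k (σ g)).comp
        (LinearMap.mulLeft k (σ f)))) =
      Module.finrank k (LinearMap.range ((LinearMap.mulRight k g).comp (LinearMap.mulLeft k f))) +
        m * (Module.finrank k (LinearMap.range (LinearMap.mulLeft k f)) *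
          Module.finrank k (LinearMap.range (LinearMap.mulRight k g))))
    {ι : Type} [Fintype ι] [DecidableEq ι] (e : ι → A) (hprim : ∀ i, IsPrimitiveIdempotent (e i))
    (hirred : ∀ i j : ι,
      Nonempty (Submodule.span A {e i} ≃ₗ[A] Submodule.span A {e j}) → i = j)
    (hcomplete : ∀ (M : Type) [AddCommGroup M] [Module A M],
      IsSimpleModule A M → ∃ i, ∃ m : M, e i • m ≠ 0) :
    Matrix.det (Matrix.of fun i j : ι => ((Module.finrank k (LinearMap.range
      ((LinearMap.mulRight k (e j)).comp (LinearMap.mulLeft k (e i))))) : ℤ)) =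
      1 + m * Module.finrank k (Π s, Matrix (Fin (d s)) (Fin (d s)) k) := by
  choose u hu using fun i => exists_unit_conj_of_retraction ρ.toRingHom σ.toRingHom hρσ hunit
    (hprim i).idem
  replace hu : ∀ i, σ (ρ (e i)) = u i * e i * ↑(u i)⁻¹ := hu
  choose s v w hwv hs using fun i => IsPrimitiveIdempotent.exists_eq_single_vecMulVec
    ((hprim i).map_retraction ρ.toRingHom σ.toRingHom hρσ hunit)
  replace hs : ∀ i, ρ (e i) = Pi.single (s i) (vecMulVec (v i) (w i)) := hs
  have hinj : Function.Injective s := by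
    intro i j hij
    obtain ⟨x, y, hx, hy, hxy, hyx⟩ := exists_mul_eq_of_single_vecMulVec hij (hwv i) (hwv j)
    rw [← hs] at hx hy hxy hyx
    have he : ∀ i, e i = ↑(u i)⁻¹ * σ (ρ (e i)) * ↑(u i) := by
      intro i
      rw [hu]
      simp [mul_assoc]
    refine hirred i j (nonempty_span_equiv_of_mul_eq (x := ↑(u i)⁻¹ * σ x * ↑(u j))
      (y := ↑(u j)⁻¹ * σ y * ↑(u i)) ?_ ?_ ?_ ?_)
    · have hx' : σ x * σ (ρ (e j)) = σ x := by rw [← map_mul, hx]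
      rw [he j]
      simp only [mul_assoc, Units.mul_inv_cancel_left]
      rw [← mul_assoc (σ x), hx']
    · have hy' : σ y * σ (ρ (e i)) = σ y := by rw [← map_mul, hy]
      rw [he i]
      simp only [mul_assoc, Units.mul_inv_cancel_left]
      rw [← mul_assoc (σ y), hy']
    · rw [he i, ← hxy, map_mul]
      simp [mul_assoc]
    · rw [he j, ← hyx, map_mul]
      simp [mul_assoc]
  have hsurj : Function.Surjective s := by
    intro t
    obtain ⟨i, hi⟩ := exists_component_ne_zero e ρ.toRingHom (fun r => ⟨σ r, hρσ r⟩) hcomplete t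
    refine ⟨i, ?_⟩
    by_contra hne
    refine hi ?_
    change ρ (e i) t = 0
    rw [hs, Pi.single_eq_of_ne (Ne.symm hne)]
  have hentry : (Matrix.of fun i j : ι => ((Module.finrank k (LinearMap.range
      ((LinearMap.mulRight k (e j)).comp (LinearMap.mulLeft k (e i))))) : ℤ)) =
      1 + replicateCol Unit (fun i => (m * d (s i) : ℤ)) *
        replicateRow Unit (fun j => (d (s j) : ℤ)) := by
    ext i j
    rw [Matrix.of_apply, ← finrank_range_mulRight_comp_mulLeft_conj (u i) (u j), ← hu, ← hu, hdim,
      hs, hs, finrank_range_mulLeft_single_vecMulVec (hwv i),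
      finrank_range_mulRight_single_vecMulVec (hwv j),
      finrank_range_sandwich_single_vecMulVec (hwv i) (hwv j)]
    simp [Matrix.one_apply, hinj.eq_iff, Matrix.mul_apply, mul_assoc]
  rw [hentry, det_one_add_replicateCol_mul_replicateRow, Module.finrank_pi_fintype]
  simp only [Module.finrank_matrix, Fintype.card_fin, Module.finrank_self, mul_one]
  have hbij : Function.Bijective s := ⟨hinj, hsurj⟩
  rw [← hbij.sum_comp]
  simp only [dotProduct, Nat.cast_sum, Nat.cast_mul, Finset.mul_sum]
  congr 1
  exact Finset.sum_congr rfl fun i _ => by ring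

end Cartan

/-- Let `L = D ⋊ E` with `D` a finite abelian `p`-group of order `p ^ n` and `E` a
`p'`-group of order `e` acting freely on `D \ {1}`, and let `k` be an algebraically
closed field of characteristic `p`.  Let `(e i)` be a complete irredundant family of
primitive idempotents of `A = kL` representing the projective indecomposable modules;
the Cartan matrix of `kL` has entries `c i j = dim_k (e i · A · e j)`.  Then
`det C = p ^ n = |D|`. -/
theorem cartan_det_eq_card_kernel (p n eo : ℕ) (hp : p.Prime) (hn : 1 ≤ n)
    {k : Type} [Field k] [IsAlgClosed k] [CharP k p]
    {D : Type} [CommGroup D] [Finite D] (hD : IsPGroup p D) (hcard : Nat.card D = p ^ n)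
    {E : Type} [Group E] [Finite E] (hE : (Nat.card E).Coprime p) (heo : Nat.card E = eo)
    (φ : E →* MulAut D)
    (hfree : ∀ f : E, f ≠ 1 → ∀ d : D, d ≠ 1 → φ f d ≠ d)
    {ι : Type} [Fintype ι] [DecidableEq ι]
    (e : ι → MonoidAlgebra k (D ⋊[φ] E))
    -- each `e i` is a nonzero primitive idempotent
    (hidem : ∀ i, IsIdempotentElem (e i)) (hne : ∀ i, e i ≠ 0)
    (hprim : ∀ i, ∀ a b : MonoidAlgebra k (D ⋊[φ] E), IsIdempotentElem a →
      IsIdempotentElem b → a * b = 0 → b * a = 0 → a + b = e i → a = 0 ∨ b = 0)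
    -- the projective modules `A·(e i)` are pairwise nonisomorphic
    (hirred : ∀ i j : ι,
      Nonempty ((↥(Submodule.span (MonoidAlgebra k (D ⋊[φ] E)) {e i})) ≃ₗ[MonoidAlgebra k (D ⋊[φ] E)]
        (↥(Submodule.span (MonoidAlgebra k (D ⋊[φ] E)) {e j}))) → i = j)
    -- and every simple module is "seen" by some `e i`
    (hcomplete : ∀ (M : Type) [AddCommGroup M] [Module (MonoidAlgebra k (D ⋊[φ] E)) M],
      IsSimpleModule (MonoidAlgebra k (D ⋊[φ] E)) M → ∃ i, ∃ m : M, e i • m ≠ 0) :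
    Matrix.det (Matrix.of fun i j : ι =>
        ((Module.finrank k (LinearMap.range
          ((LinearMap.mulRight k (e j)).comp (LinearMap.mulLeft k (e i))))) : ℤ)) =
      (Nat.card D : ℤ) := by
  have : Fact p.Prime := ⟨hp⟩
  have hne0 : NeZero (Nat.card E : k) := ⟨fun h => by
    rw [CharP.cast_eq_zero_iff k p] at h
    exact hp.one_lt.ne' (Nat.eq_one_of_dvd_coprimes hE h dvd_rfl)⟩
  have hpow : ∀ d : D, d ^ p ^ n = 1 := fun d => hcard ▸ pow_card_eq_one'
  obtain ⟨N, d, _, ⟨θ⟩⟩ :=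
    IsSemisimpleRing.exists_algEquiv_pi_matrix_of_isAlgClosed k (MonoidAlgebra k E)
  obtain ⟨m, hm, hdim⟩ := exists_finrank_range_sandwich (k := k) φ hfree
  have hfinrank : Module.finrank k (Π i, Matrix (Fin (d i)) (Fin (d i)) k) = Nat.card E := by
    rw [← θ.toLinearEquiv.finrank_eq]
    exact Module.finrank_eq_nat_card_basis (MonoidAlgebra.basis E k)
  rw [det_cartan_of_retraction (θ.toAlgHom.comp (semidirectProj φ))
    ((semidirectIncl φ).comp θ.symm.toAlgHom) ?_ ?_ m ?_ e
    (fun i => ⟨hidem i, hne i, hprim i⟩) hirred hcomplete, hfinrank, hm]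
  · push_cast
    rfl
  · intro r
    change θ (semidirectProj φ (semidirectIncl φ (θ.symm r))) = r
    rw [semidirectProj_semidirectIncl, AlgEquiv.apply_symm_apply]
  · intro u hu
    refine isUnit_of_semidirectProj_eq_one φ p n hpow u (θ.injective ?_)
    rw [map_one]
    exact hu
  · intro f g
    have h := hdim (θ.symm f) (θ.symm g)
    refine h.trans ?_
    have hL : LinearMap.mulLeft k f = (θ.toLinearMap.comp
        (LinearMap.mulLeft k (θ.symm f))).comp θ.symm.toLinearMap := by
      exact LinearMap.ext fun x => by simp
    have hR : LinearMap.mulRight k g = (θ.toLinearMap.comp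
        (LinearMap.mulRight k (θ.symm g))).comp θ.symm.toLinearMap := by
      exact LinearMap.ext fun x => by simp
    have hC : (LinearMap.mulRight k g).comp (LinearMap.mulLeft k f) = (θ.toLinearMap.comp
        ((LinearMap.mulRight k (θ.symm g)).comp (LinearMap.mulLeft k (θ.symm f)))).comp
        θ.symm.toLinearMap := by
      exact LinearMap.ext fun x => by simp
    have hfin : ∀ F : MonoidAlgebra k E →ₗ[k] MonoidAlgebra k E, Module.finrank k
        (LinearMap.range ((θ.toLinearMap.comp F).comp θ.symm.toLinearMap)) =
        Module.finrank k (LinearMap.range F) := by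
      intro F
      rw [LinearMap.range_comp_of_range_eq_top _ (LinearMap.range_eq_top.2 θ.symm.surjective),
        LinearMap.range_comp]
      exact LinearEquiv.finrank_map_eq θ.toLinearEquiv _
    rw [hC, hL, hR, hfin, hfin, hfin]
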